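/- arXiv:1003.5987 — 5 statements merged into one kernel-verified Lean document; each statement's English description precedes it below -/
import Mathlib

section
/- Suppose τ satisfies the Fay identity. Then for all t : ℕ → ℂ and all nonzero s₁, s₂, s₃ ∈ ℂ with s_i ≠ ±s_j for all i ≠ j: [(s₁−s₂)(s₁−s₃)/((s₁+s₂)(s₁+s₃))]·τ(t)·τ(t−2[s₁]−2[s₂]−2[s₃]) + [(s₂+s₃)(s₂−s₁)/((s₂−s₃)(s₂+s₁))]·τ(t−2[s₂]−2[s₁])·τ(t−2[s₃]) + [(s₃−s₁)(s₃+s₂)/((s₃+s₁)(s₃−s₂))]·τ(t−2[s₁]−2[s₃])·τ(t−2[s₂]) − τ(t−2[s₁])·τ(t−2[s₂]−2[s₃]) = 0. (This is obtained from the Fay identity by setting s₀ = 0, shifting t ↦ t−2[s₂]−2[s₃] and replacing s₁ by −s₁; with s₁ = μ⁻¹, s₂ = z⁻¹, s₃ = λ⁻¹ it is the identity C = 0 in the proof of Lemma 4.1.) -/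
open Complex

noncomputable section

/-- The shifted time sequence `t + 2[s]`, given by `(t + 2[s]) n = t n + 2 s^(2n+1)/(2n+1)`. -/
def shift (t : ℕ → ℂ) (s : ℂ) : ℕ → ℂ :=
  fun n => t n + 2 * s ^ (2 * n + 1) / ((2 * n + 1 : ℕ) : ℂ)

/-- `ξ(t,z) = Σ_n t_n z^(2n+1)` (a finite sum for finitely supported `t`). -/
def xi (t : ℕ → ℂ) (z : ℂ) : ℂ := ∑ᶠ n : ℕ, t n * z ^ (2 * n + 1)

/-- Derivative with respect to `x = t₁` (coordinate `0`). -/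
def dx (F : (ℕ → ℂ) → ℂ) (t : ℕ → ℂ) : ℂ :=
  deriv (fun y => F (Function.update t 0 y)) (t 0)

/-- The Fay identity of the BKP hierarchy. -/
def FayIdentity (τ : (ℕ → ℂ) → ℂ) : Prop :=
  ∀ (t : ℕ → ℂ) (s₀ s₁ s₂ s₃ : ℂ),
    s₁ + s₀ ≠ 0 → s₂ + s₀ ≠ 0 → s₃ + s₀ ≠ 0 →
    s₁ - s₂ ≠ 0 → s₁ - s₃ ≠ 0 → s₂ - s₃ ≠ 0 →
    (s₁ - s₀) * (s₁ + s₂) * (s₁ + s₃) / ((s₁ + s₀) * (s₁ - s₂) * (s₁ - s₃)) *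
        (τ (shift (shift t s₂) s₃) * τ (shift (shift t s₀) s₁))
      + (s₂ - s₀) * (s₂ + s₃) * (s₂ + s₁) / ((s₂ + s₀) * (s₂ - s₃) * (s₂ - s₁)) *
        (τ (shift (shift t s₃) s₁) * τ (shift (shift t s₀) s₂))
      + (s₃ - s₀) * (s₃ + s₁) * (s₃ + s₂) / ((s₃ + s₀) * (s₃ - s₁) * (s₃ - s₂)) *
        (τ (shift (shift t s₁) s₂) * τ (shift (shift t s₀) s₃))
      + (s₀ - s₁) * (s₀ - s₂) * (s₀ - s₃) / ((s₀ + s₁) * (s₀ + s₂) * (s₀ + s₃)) *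
        (τ (shift (shift (shift (shift t s₀) s₁) s₂) s₃) * τ t) = 0

/-- The differential Fay identity of the BKP hierarchy. -/
def DiffFay (τ : (ℕ → ℂ) → ℂ) : Prop :=
  ∀ (t : ℕ → ℂ) (s₁ s₂ : ℂ), s₁ ≠ 0 → s₂ ≠ 0 →
    (1 / s₂ ^ 2 - 1 / s₁ ^ 2) *
        (τ (shift t s₁) * τ (shift t s₂) - τ (shift (shift t s₁) s₂) * τ t)
      = (1 / s₂ + 1 / s₁) *
          (dx τ (shift t s₂) * τ (shift t s₁) - dx τ (shift t s₁) * τ (shift t s₂))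
        + (1 / s₂ - 1 / s₁) *
          (τ (shift (shift t s₁) s₂) * dx τ t - dx τ (shift (shift t s₁) s₂) * τ t)

theorem shift_zero (t : ℕ → ℂ) : shift t 0 = t := by
  funext n
  simp [shift]

theorem shift_comm (t : ℕ → ℂ) (a b : ℂ) : shift (shift t a) b = shift (shift t b) a := by
  funext n
  simp only [shift]
  ring

theorem shift_neg_shift (t : ℕ → ℂ) (a : ℂ) : shift (shift t (-a)) a = t := by
  funext n
  simp only [shift, Odd.neg_pow (odd_two_mul_add_one n)]
  ring

/-- The Fay identity with `s₀ = 0`, after the shift `t ↦ t − 2[s₂] − 2[s₃]` and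
`s₁ ↦ −s₁` (identity `C = 0` in the proof of Lemma 4.1). -/
theorem fay_shifted_negated (τ : (ℕ → ℂ) → ℂ) (hFay : FayIdentity τ)
    (t : ℕ → ℂ) (s₁ s₂ s₃ : ℂ)
    (h₁ : s₁ ≠ 0) (h₂ : s₂ ≠ 0) (h₃ : s₃ ≠ 0)
    (h₁₂ : s₁ ≠ s₂) (h₁₂' : s₁ ≠ -s₂)
    (h₁₃ : s₁ ≠ s₃) (h₁₃' : s₁ ≠ -s₃)
    (h₂₃ : s₂ ≠ s₃) (h₂₃' : s₂ ≠ -s₃) :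
    (s₁ - s₂) * (s₁ - s₃) / ((s₁ + s₂) * (s₁ + s₃)) *
        (τ t * τ (shift (shift (shift t (-s₁)) (-s₂)) (-s₃)))
      + (s₂ + s₃) * (s₂ - s₁) / ((s₂ - s₃) * (s₂ + s₁)) *
        (τ (shift (shift t (-s₂)) (-s₁)) * τ (shift t (-s₃)))
      + (s₃ - s₁) * (s₃ + s₂) / ((s₃ + s₁) * (s₃ - s₂)) *
        (τ (shift (shift t (-s₁)) (-s₃)) * τ (shift t (-s₂)))
      - τ (shift t (-s₁)) * τ (shift (shift t (-s₂)) (-s₃)) = 0 := by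
  have add₁₂ : s₁ + s₂ ≠ 0 := fun h => h₁₂' (eq_neg_of_add_eq_zero_left h)
  have add₁₃ : s₁ + s₃ ≠ 0 := fun h => h₁₃' (eq_neg_of_add_eq_zero_left h)
  have key := hFay (shift (shift t (-s₂)) (-s₃)) 0 (-s₁) s₂ s₃
    (by simpa using h₁) (by simpa using h₂) (by simpa using h₃)
    (by rw [← neg_add']; exact neg_ne_zero.mpr add₁₂)
    (by rw [← neg_add']; exact neg_ne_zero.mpr add₁₃) (sub_ne_zero.mpr h₂₃)
  have e₂ : shift (shift (shift t (-s₂)) (-s₃)) s₂ = shift t (-s₃) := by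
    rw [shift_comm t, shift_neg_shift]
  have e₁ : shift (shift (shift t (-s₂)) (-s₃)) (-s₁) =
      shift (shift (shift t (-s₁)) (-s₂)) (-s₃) := by
    rw [shift_comm _ (-s₃), shift_comm t (-s₂)]
  have e₁₂ : shift (shift (shift (shift t (-s₁)) (-s₂)) (-s₃)) s₂ =
      shift (shift t (-s₁)) (-s₃) := by
    rw [shift_comm _ (-s₂), shift_neg_shift]
  rw [shift_zero, e₁, e₁₂, e₂, shift_neg_shift, shift_neg_shift, shift_neg_shift] at key
  have c₁ : (-s₁ - 0) * (-s₁ + s₂) * (-s₁ + s₃) / ((-s₁ + 0) * (-s₁ - s₂) * (-s₁ - s₃)) =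
      (s₁ - s₂) * (s₁ - s₃) / ((s₁ + s₂) * (s₁ + s₃)) := by
    rw [show (-s₁ - 0) * (-s₁ + s₂) * (-s₁ + s₃) = -s₁ * ((s₁ - s₂) * (s₁ - s₃)) by ring,
      show (-s₁ + 0) * (-s₁ - s₂) * (-s₁ - s₃) = -s₁ * ((s₁ + s₂) * (s₁ + s₃)) by ring,
      mul_div_mul_left _ _ (neg_ne_zero.mpr h₁)]
  have c₂ : (s₂ - 0) * (s₂ + s₃) * (s₂ + -s₁) / ((s₂ + 0) * (s₂ - s₃) * (s₂ - -s₁)) =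
      (s₂ + s₃) * (s₂ - s₁) / ((s₂ - s₃) * (s₂ + s₁)) := by
    rw [sub_zero, add_zero, sub_neg_eq_add, ← sub_eq_add_neg, mul_assoc, mul_assoc,
      mul_div_mul_left _ _ h₂]
  have c₃ : (s₃ - 0) * (s₃ + -s₁) * (s₃ + s₂) / ((s₃ + 0) * (s₃ - -s₁) * (s₃ - s₂)) =
      (s₃ - s₁) * (s₃ + s₂) / ((s₃ + s₁) * (s₃ - s₂)) := by
    rw [sub_zero, add_zero, sub_neg_eq_add, ← sub_eq_add_neg, mul_assoc, mul_assoc,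
      mul_div_mul_left _ _ h₃]
  have c₀ : (0 - -s₁) * (0 - s₂) * (0 - s₃) / ((0 + -s₁) * (0 + s₂) * (0 + s₃)) = -1 := by
    simp only [zero_add, zero_sub, neg_neg]
    field_simp
  rw [c₁, c₂, c₃, c₀] at key
  linear_combination key
end
end

section
/- Suppose τ satisfies the Fay identity. Then for all t : ℕ → ℂ and all nonzero μ, z, λ ∈ ℂ with μ ≠ ±z, μ ≠ ±λ and z ≠ ±λ: [(z−μ)(z−λ)(μ−λ)/((z+μ)(z+λ)(μ+λ))]·τ(t−2[μ⁻¹]−2[z⁻¹]−2[λ⁻¹])·τ(t) − [(μ−λ)/(μ+λ)]·τ(t−2[μ⁻¹]−2[λ⁻¹])·τ(t−2[z⁻¹]) + [(z−λ)/(z+λ)]·τ(t−2[μ⁻¹])·τ(t−2[z⁻¹]−2[λ⁻¹]) − [(z−μ)/(z+μ)]·τ(t−2[λ⁻¹])·τ(t−2[z⁻¹]−2[μ⁻¹]) = 0. (This τ-function identity is the exponential-free equivalent of Lemma 4.1, the shift-difference identity for BKP Baker–Akhiezer functions.) -/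
open Complex

noncomputable section

theorem fay_coeff_inv {x y w : ℂ} (hx : x ≠ 0) (hy : y ≠ 0) (hw : w ≠ 0)
    (hxy : x - y ≠ 0) (hxw : x - w ≠ 0) :
    (x⁻¹ - 0) * (x⁻¹ + y⁻¹) * (x⁻¹ + w⁻¹) / ((x⁻¹ + 0) * (x⁻¹ - y⁻¹) * (x⁻¹ - w⁻¹))
      = (x + y) * (x + w) / ((x - y) * (x - w)) := by
  have h₁ : x⁻¹ - y⁻¹ = -(x - y) / (x * y) := by field_simp; ring
  have h₂ : x⁻¹ - w⁻¹ = -(x - w) / (x * w) := by field_simp; ring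
  rw [h₁, h₂]
  field_simp
  ring

/-- The τ-function identity equivalent to the shift-difference identity (Lemma 4.1)
for BKP Baker–Akhiezer functions. -/
theorem tau_shift_difference (τ : (ℕ → ℂ) → ℂ) (hFay : FayIdentity τ)
    (t : ℕ → ℂ) (μ z lam : ℂ)
    (hmu : μ ≠ 0) (hz : z ≠ 0) (hlam : lam ≠ 0)
    (hmz : μ ≠ z) (hmz' : μ ≠ -z)
    (hml : μ ≠ lam) (hml' : μ ≠ -lam)
    (hzl : z ≠ lam) (hzl' : z ≠ -lam) :
    (z - μ) * (z - lam) * (μ - lam) / ((z + μ) * (z + lam) * (μ + lam)) *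
        (τ (shift (shift (shift t (-μ⁻¹)) (-z⁻¹)) (-lam⁻¹)) * τ t)
      - (μ - lam) / (μ + lam) *
        (τ (shift (shift t (-μ⁻¹)) (-lam⁻¹)) * τ (shift t (-z⁻¹)))
      + (z - lam) / (z + lam) *
        (τ (shift t (-μ⁻¹)) * τ (shift (shift t (-z⁻¹)) (-lam⁻¹)))
      - (z - μ) / (z + μ) *
        (τ (shift t (-lam⁻¹)) * τ (shift (shift t (-z⁻¹)) (-μ⁻¹))) = 0 := by
  have d₁ : z + μ ≠ 0 := fun h => hmz' (by linear_combination h)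
  have d₂ : z + lam ≠ 0 := fun h => hzl' (by linear_combination h)
  have d₃ : μ + lam ≠ 0 := fun h => hml' (by linear_combination h)
  have e₁ : μ⁻¹ - z⁻¹ ≠ 0 := sub_ne_zero.mpr (inv_injective.ne hmz)
  have e₂ : μ⁻¹ - lam⁻¹ ≠ 0 := sub_ne_zero.mpr (inv_injective.ne hml)
  have e₃ : z⁻¹ - lam⁻¹ ≠ 0 := sub_ne_zero.mpr (inv_injective.ne hzl)
  set a := μ⁻¹ with ha
  set b := z⁻¹ with hb
  set c := lam⁻¹ with hc
  have a₀ : a ≠ 0 := inv_ne_zero hmu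
  have b₀ : b ≠ 0 := inv_ne_zero hz
  have c₀ : c ≠ 0 := inv_ne_zero hlam
  set u := shift (shift (shift t (-a)) (-b)) (-c) with hu
  have uc : shift u c = shift (shift t (-a)) (-b) := shift_neg_shift _ _
  have ub : shift u b = shift (shift t (-a)) (-c) := by
    rw [hu, shift_comm _ (-b) (-c), shift_neg_shift]
  have ua : shift u a = shift (shift t (-b)) (-c) := by
    rw [hu, shift_comm t (-a) (-b), shift_comm _ (-a) (-c), shift_neg_shift]
  have ubc : shift (shift u b) c = shift t (-a) := by rw [ub, shift_neg_shift]
  have uca : shift (shift u c) a = shift t (-b) := by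
    rw [uc, shift_comm t, shift_neg_shift]
  have uab : shift (shift u a) b = shift t (-c) := by
    rw [ua, shift_comm t, shift_neg_shift]
  have uabc : shift (shift (shift u a) b) c = t := by rw [uab, shift_neg_shift]
  have fay := hFay u 0 a b c (by simpa using a₀) (by simpa using b₀) (by simpa using c₀) e₁ e₂ e₃
  rw [shift_zero, uabc, uab, ubc, uca, ua, ub, uc] at fay
  rw [shift_comm t (-b) (-a)]
  have hab : z - μ ≠ 0 := sub_ne_zero.mpr hmz.symm
  have hbc : z - lam ≠ 0 := sub_ne_zero.mpr hzl
  have hac : μ - lam ≠ 0 := sub_ne_zero.mpr hml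
  have hab' : μ - z ≠ 0 := sub_ne_zero.mpr hmz
  have hbc' : lam - z ≠ 0 := sub_ne_zero.mpr hzl.symm
  have hac' : lam - μ ≠ 0 := sub_ne_zero.mpr hml.symm
  have last : (0 - a) * (0 - b) * (0 - c) / ((0 + a) * (0 + b) * (0 + c)) = -1 := by
    simp only [zero_sub, zero_add]
    field_simp
  rw [last, ha, hb, hc, fay_coeff_inv hmu hz hlam hab' hac, fay_coeff_inv hz hlam hmu hbc hab,
    fay_coeff_inv hlam hmu hz hac' hbc', ← neg_sub z μ, ← neg_sub μ lam, ← neg_sub z lam] at fay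
  simp only [← ha, ← hb, ← hc] at fay
  have s₁ : μ + z = z + μ := add_comm _ _
  have s₂ : lam + z = z + lam := add_comm _ _
  have s₃ : lam + μ = μ + lam := add_comm _ _
  rw [s₁, s₂, s₃] at fay
  linear_combination (norm := skip)
    (-((z - μ) * (z - lam) * (μ - lam) / ((z + μ) * (z + lam) * (μ + lam)))) * fay
  field_simp
  ring
end
end

section
/- Suppose τ admits ∂ₓτ at every point and satisfies the differential Fay identity. Let t : ℕ → ℂ be finitely supported, and let λ, μ be nonzero complex numbers with λ ≠ ±μ, τ(t) ≠ 0 and τ(t−2[μ⁻¹]) ≠ 0. Then ψ(t,μ)·∂ₓ[ψ(·,−λ)](t) = (1/2)·∂ₓ[(ψ(·,−λ) − ψ(·−2[μ⁻¹],−λ))·ψ(·,μ)](t), where ψ(t,μ) = exp(ξ(t,μ))·τ(t−2[μ⁻¹])/τ(t), ψ(t,−λ) = exp(−ξ(t,λ))·τ(t+2[λ⁻¹])/τ(t), ψ(t−2[μ⁻¹],−λ) = exp(−ξ(t,λ))·((μ+λ)/(μ−λ))·τ(t−2[μ⁻¹]+2[λ⁻¹])/τ(t−2[μ⁻¹]),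 and ∂ₓ is applied to each bracketed expression as a function of t via the first coordinate. (This is the x-derivative form of the squared eigenfunction potential formula S(ψ_BA(t,μ), ∂ₓψ_BA(t,−λ)) = ½(ψ_BA(t,−λ) − ψ_BA(t−2[μ⁻¹],−λ))·ψ_BA(t,μ), eq. (3.14)/Corollary 3.4(i).) -/
open Complex

noncomputable section

lemma shift_update_zero (t : ℕ → ℂ) (s y : ℂ) :
    shift (Function.update t 0 y) s = Function.update (shift t s) 0 (y + 2 * s) := by
  funext n
  rcases eq_or_ne n 0 with rfl | hn
  · simp [shift]
  · simp [shift, hn]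

lemma shift_apply_zero (t : ℕ → ℂ) (s : ℂ) : shift t s 0 = t 0 + 2 * s := by
  simp [shift]

lemma xi_update_zero {t : ℕ → ℂ} (ht : (Function.support t).Finite) (z y : ℂ) :
    xi (Function.update t 0 y) z = xi t z + (y - t 0) * z := by
  have hterm : ∀ n : ℕ, Function.update t 0 y n * z ^ (2 * n + 1)
      = t n * z ^ (2 * n + 1) + (Pi.single 0 ((y - t 0) * z) : ℕ → ℂ) n := by
    intro n
    rcases eq_or_ne n 0 with rfl | hn
    · simp
      ring
    · simp [hn]
  unfold xi
  rw [finsum_congr hterm, finsum_add_distrib]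
  · congr 1
    rw [finsum_eq_single _ 0 (fun n hn => by simp [hn])]
    simp
  · exact ht.subset fun n hn h => hn (by simp [h])
  · exact (Set.finite_singleton 0).subset Pi.support_single_subset

lemma hasDerivAt_xi_update {t : ℕ → ℂ} (ht : (Function.support t).Finite) (z : ℂ) :
    HasDerivAt (fun y => xi (Function.update t 0 y) z) z (t 0) := by
  simp only [xi_update_zero ht]
  simpa using (((hasDerivAt_id (t 0)).sub_const (t 0)).mul_const z).const_add (xi t z)

lemma HasDerivAt.comp_shift_update {F : (ℕ → ℂ) → ℂ} {t : ℕ → ℂ} {s F' : ℂ}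
    (h : HasDerivAt (fun y => F (Function.update (shift t s) 0 y)) F' (shift t s 0)) :
    HasDerivAt (fun y => F (shift (Function.update t 0 y) s)) F' (t 0) := by
  simp only [shift_update_zero]
  rw [shift_apply_zero] at h
  exact h.comp_add_const (t 0) (2 * s)


/-- The x-derivative form of the SEP formula
`S(ψ_BA(t,μ), ∂ₓψ_BA(t,−λ)) = ½(ψ_BA(t,−λ) − ψ_BA(t−2[μ⁻¹],−λ))·ψ_BA(t,μ)` (eq. (3.14)). -/
theorem sep_basic_x_derivative (τ : (ℕ → ℂ) → ℂ)
    (hdiff : ∀ t : ℕ → ℂ, DifferentiableAt ℂ (fun y => τ (Function.update t 0 y)) (t 0))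
    (hdFay : DiffFay τ)
    (t : ℕ → ℂ) (hsupp : (Function.support t).Finite)
    (lam μ : ℂ) (hlam : lam ≠ 0) (hmu : μ ≠ 0)
    (hml : lam ≠ μ) (hml' : lam ≠ -μ)
    (ht : τ t ≠ 0) (htm : τ (shift t (-μ⁻¹)) ≠ 0) :
    (Complex.exp (xi t μ) * τ (shift t (-μ⁻¹)) / τ t) *
        dx (fun u => Complex.exp (-xi u lam) * τ (shift u lam⁻¹) / τ u) t
      = (1 / 2) *
          dx (fun u =>
            (Complex.exp (-xi u lam) * τ (shift u lam⁻¹) / τ u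
              - Complex.exp (-xi u lam) * ((μ + lam) / (μ - lam)) *
                  τ (shift (shift u (-μ⁻¹)) lam⁻¹) / τ (shift u (-μ⁻¹))) *
            (Complex.exp (xi u μ) * τ (shift u (-μ⁻¹)) / τ u)) t := by
  have hτ : ∀ u : ℕ → ℂ, HasDerivAt (fun y => τ (Function.update u 0 y)) (dx τ u) (u 0) :=
    fun u => (hdiff u).hasDerivAt
  have hA := hτ t
  have hB := (hτ (shift t (-μ⁻¹))).comp_shift_update
  have hC := (hτ (shift t lam⁻¹)).comp_shift_update
  have hD := (HasDerivAt.comp_shift_update (F := fun u => τ (shift u lam⁻¹))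
    (hτ (shift (shift t (-μ⁻¹)) lam⁻¹)).comp_shift_update)
  have hE := (hasDerivAt_xi_update hsupp lam).neg.cexp
  have hG := (hasDerivAt_xi_update hsupp μ).cexp
  have hA0 : τ (Function.update t 0 (t 0)) ≠ 0 := by simpa using ht
  have hB0 : τ (shift (Function.update t 0 (t 0)) (-μ⁻¹)) ≠ 0 := by simpa using htm
  have hψ := (hE.mul hC).div hA hA0
  have hψ' := ((hE.mul_const ((μ + lam) / (μ - lam))).mul hD).div hB hB0
  have hL := hψ.deriv
  have hR := ((hψ.sub hψ').mul ((hG.mul hB).div hA hA0)).deriv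
  have hF := hdFay t (-μ⁻¹) lam⁻¹ (by simpa using hmu) (by simpa using hlam)
  have hsub : μ - lam ≠ 0 := sub_ne_zero.mpr hml.symm
  unfold dx
  erw [hL, hR]
  simp only [Function.update_eq_self, Pi.neg_apply, Pi.mul_apply, Pi.sub_apply, Pi.div_apply]
  generalize dx τ t = A' at *
  generalize dx τ (shift t (-μ⁻¹)) = B' at *
  generalize dx τ (shift t lam⁻¹) = C' at *
  generalize dx τ (shift (shift t (-μ⁻¹)) lam⁻¹) = D' at *
  generalize τ (shift (shift t (-μ⁻¹)) lam⁻¹) = D at *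
  generalize τ (shift t (-μ⁻¹)) = B at *
  generalize τ (shift t lam⁻¹) = C at *
  generalize τ t = A at *
  generalize Complex.exp (-xi t lam) = E
  generalize Complex.exp (xi t μ) = G
  clear hL hR hψ hψ' hA hB hC hD hE hG
  simp only [one_div, inv_inv, inv_neg, inv_pow, neg_sq] at hF
  have hFay : (μ + lam) * (C * B - D * A) * (μ - lam) + (B' * C - C' * B) * (μ - lam)
      + (μ + lam) * (D * A' - D' * A) = 0 := by
    linear_combination -hF
  field_simp
  linear_combination -(G * B * E * A) * hFay
end
end

section
/- Suppose τ satisfies the Fay identity. Let t : ℕ → ℂ be finitely supported and let λ, μ, z be nonzero complex numbers with λ ≠ ±μ, λ ≠ ±z, μ ≠ ±z, and with τ(t), τ(t−2[μ⁻¹]), τ(t−2[z⁻¹]) and τ(t−2[μ⁻¹]−2[z⁻¹]) all nonzero. Then ψ(t−2[z⁻¹],μ)·ψ(t−2[μ⁻¹]−2[z⁻¹],λ) − ψ(t,μ)·ψ(t−2[μ⁻¹],λ) = ψ(t,λ)·ψ(t−2[z⁻¹],μ) − ψ(t,μ)·ψ(t−2[z⁻¹],λ), where ψ(t,ν) = exp(ξ(t,ν))·τ(t−2[ν⁻¹])/τ(t)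 for ν ∈ {λ,μ}, ψ(t−2[μ⁻¹],λ) = exp(ξ(t,λ))·((μ−λ)/(μ+λ))·τ(t−2[μ⁻¹]−2[λ⁻¹])/τ(t−2[μ⁻¹]), ψ(t−2[z⁻¹],ν) = exp(ξ(t,ν))·((z−ν)/(z+ν))·τ(t−2[z⁻¹]−2[ν⁻¹])/τ(t−2[z⁻¹]) for ν ∈ {λ,μ}, and ψ(t−2[μ⁻¹]−2[z⁻¹],λ) = exp(ξ(t,λ))·((μ−λ)/(μ+λ))·((z−λ)/(z+λ))·τ(t−2[μ⁻¹]−2[z⁻¹]−2[λ⁻¹])/τ(t−2[μ⁻¹]−2[z⁻¹]). (Lemma 4.1 of the paper: Δ_z(ψ_BA(t,μ)·ψ_BA(t−2[μ⁻¹],λ)) = ψ_BA(t,λ)·ψ_BA(t−2[z⁻¹],μ) − ψ_BA(t,μ)·ψ_BA(t−2[z⁻¹],λ), where Δ_z F(t) = F(t−2[z⁻¹]) − F(t).) -/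
open Complex

noncomputable section

/-- For nonzero complex numbers, the Fay coefficient of a pair of negated inverses. -/
theorem neg_inv_add_div_sub {a b : ℂ} (ha : a ≠ 0) (hb : b ≠ 0) (hab : a ≠ b) :
    (-a⁻¹ + -b⁻¹) / (-a⁻¹ - -b⁻¹) = (b + a) / (b - a) := by
  have h : b - a ≠ 0 := sub_ne_zero.mpr hab.symm
  have h' : -a⁻¹ - -b⁻¹ ≠ 0 := by
    intro h0
    exact hab (inv_injective (neg_injective (sub_eq_zero.mp h0)))
  rw [div_eq_div_iff h' h]
  field_simp
  ring

/-- The Fay identity with `s₀ = 0`. -/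
theorem FayIdentity.three_term {τ : (ℕ → ℂ) → ℂ} (hFay : FayIdentity τ) (t : ℕ → ℂ)
    {s₁ s₂ s₃ : ℂ} (h₁ : s₁ ≠ 0) (h₂ : s₂ ≠ 0) (h₃ : s₃ ≠ 0)
    (h₁₂ : s₁ ≠ s₂) (h₁₃ : s₁ ≠ s₃) (h₂₃ : s₂ ≠ s₃) :
    (s₁ + s₂) / (s₁ - s₂) * ((s₁ + s₃) / (s₁ - s₃)) *
        (τ (shift (shift t s₂) s₃) * τ (shift t s₁))
      - (s₂ + s₃) / (s₂ - s₃) * ((s₁ + s₂) / (s₁ - s₂)) *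
        (τ (shift (shift t s₃) s₁) * τ (shift t s₂))
      + (s₁ + s₃) / (s₁ - s₃) * ((s₂ + s₃) / (s₂ - s₃)) *
        (τ (shift (shift t s₁) s₂) * τ (shift t s₃))
      = τ (shift (shift (shift t s₁) s₂) s₃) * τ t := by
  have d₁₂ := sub_ne_zero.mpr h₁₂
  have d₁₃ := sub_ne_zero.mpr h₁₃
  have d₂₃ := sub_ne_zero.mpr h₂₃
  have h := hFay t 0 s₁ s₂ s₃ (by simpa) (by simpa) (by simpa) d₁₂ d₁₃ d₂₃
  have c₁ : (s₁ - 0) * (s₁ + s₂) * (s₁ + s₃) / ((s₁ + 0) * (s₁ - s₂) * (s₁ - s₃))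
      = (s₁ + s₂) / (s₁ - s₂) * ((s₁ + s₃) / (s₁ - s₃)) := by
    rw [sub_zero, add_zero]
    field_simp
  have c₂ : (s₂ - 0) * (s₂ + s₃) * (s₂ + s₁) / ((s₂ + 0) * (s₂ - s₃) * (s₂ - s₁))
      = -((s₂ + s₃) / (s₂ - s₃) * ((s₁ + s₂) / (s₁ - s₂))) := by
    rw [sub_zero, add_zero, ← neg_sub s₁ s₂]
    field_simp
    ring
  have c₃ : (s₃ - 0) * (s₃ + s₁) * (s₃ + s₂) / ((s₃ + 0) * (s₃ - s₁) * (s₃ - s₂))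
      = (s₁ + s₃) / (s₁ - s₃) * ((s₂ + s₃) / (s₂ - s₃)) := by
    rw [sub_zero, add_zero, ← neg_sub s₁ s₃, ← neg_sub s₂ s₃]
    field_simp
    ring
  have c₄ : (0 - s₁) * (0 - s₂) * (0 - s₃) / ((0 + s₁) * (0 + s₂) * (0 + s₃)) = -1 := by
    simp only [zero_sub, zero_add]
    field_simp
  rw [c₁, c₂, c₃, c₄, shift_zero] at h
  linear_combination h

/-- Lemma 4.1: `Δ_z(ψ_BA(t,μ)·ψ_BA(t−2[μ⁻¹],λ)) = ψ_BA(t,λ)·ψ_BA(t−2[z⁻¹],μ) −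
ψ_BA(t,μ)·ψ_BA(t−2[z⁻¹],λ)`, written with explicit evaluations of the
Baker–Akhiezer functions. -/
theorem shift_difference_psi (τ : (ℕ → ℂ) → ℂ) (hFay : FayIdentity τ)
    (t : ℕ → ℂ) (hsupp : (Function.support t).Finite)
    (lam μ z : ℂ) (hlam : lam ≠ 0) (hmu : μ ≠ 0) (hz : z ≠ 0)
    (hlm : lam ≠ μ) (hlm' : lam ≠ -μ)
    (hlz : lam ≠ z) (hlz' : lam ≠ -z)
    (hmz : μ ≠ z) (hmz' : μ ≠ -z)
    (ht : τ t ≠ 0) (htm : τ (shift t (-μ⁻¹)) ≠ 0)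
    (htz : τ (shift t (-z⁻¹)) ≠ 0) (htmz : τ (shift (shift t (-μ⁻¹)) (-z⁻¹)) ≠ 0) :
    (Complex.exp (xi t μ) * ((z - μ) / (z + μ)) *
          τ (shift (shift t (-z⁻¹)) (-μ⁻¹)) / τ (shift t (-z⁻¹))) *
        (Complex.exp (xi t lam) * ((μ - lam) / (μ + lam)) * ((z - lam) / (z + lam)) *
          τ (shift (shift (shift t (-μ⁻¹)) (-z⁻¹)) (-lam⁻¹)) /
            τ (shift (shift t (-μ⁻¹)) (-z⁻¹)))
      - (Complex.exp (xi t μ) * τ (shift t (-μ⁻¹)) / τ t) *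
          (Complex.exp (xi t lam) * ((μ - lam) / (μ + lam)) *
            τ (shift (shift t (-μ⁻¹)) (-lam⁻¹)) / τ (shift t (-μ⁻¹)))
      = (Complex.exp (xi t lam) * τ (shift t (-lam⁻¹)) / τ t) *
          (Complex.exp (xi t μ) * ((z - μ) / (z + μ)) *
            τ (shift (shift t (-z⁻¹)) (-μ⁻¹)) / τ (shift t (-z⁻¹)))
        - (Complex.exp (xi t μ) * τ (shift t (-μ⁻¹)) / τ t) *
          (Complex.exp (xi t lam) * ((z - lam) / (z + lam)) *
            τ (shift (shift t (-z⁻¹)) (-lam⁻¹)) / τ (shift t (-z⁻¹))) := by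
  have p₁ : μ + lam ≠ 0 := fun h => hlm' (eq_neg_of_add_eq_zero_right h)
  have p₂ : z + lam ≠ 0 := fun h => hlz' (eq_neg_of_add_eq_zero_right h)
  have p₃ : z + μ ≠ 0 := fun h => hmz' (eq_neg_of_add_eq_zero_right h)
  have m₁ : μ - lam ≠ 0 := sub_ne_zero.mpr hlm.symm
  have m₂ : z - lam ≠ 0 := sub_ne_zero.mpr hlz.symm
  have m₃ : z - μ ≠ 0 := sub_ne_zero.mpr hmz.symm
  have ne {a b : ℂ} (h : a ≠ b) : -a⁻¹ ≠ -b⁻¹ := fun h0 => h (inv_injective (neg_injective h0))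
  have key := hFay.three_term t (neg_ne_zero.mpr (inv_ne_zero hmu))
    (neg_ne_zero.mpr (inv_ne_zero hz)) (neg_ne_zero.mpr (inv_ne_zero hlam))
    (ne hmz) (ne hlm.symm) (ne hlz.symm)
  rw [neg_inv_add_div_sub hmu hz hmz, neg_inv_add_div_sub hmu hlam hlm.symm,
    neg_inv_add_div_sub hz hlam hlz.symm, shift_comm t (-lam⁻¹)] at key
  rw [shift_comm t (-z⁻¹) (-μ⁻¹)]
  generalize τ (shift (shift (shift t (-μ⁻¹)) (-z⁻¹)) (-lam⁻¹)) = T at *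
  generalize τ (shift (shift t (-μ⁻¹)) (-z⁻¹)) = Tmz at *
  generalize τ (shift (shift t (-μ⁻¹)) (-lam⁻¹)) = Tml at *
  generalize τ (shift (shift t (-z⁻¹)) (-lam⁻¹)) = Tzl at *
  generalize τ (shift t (-μ⁻¹)) = Tm at *
  generalize τ (shift t (-z⁻¹)) = Tz at *
  generalize τ (shift t (-lam⁻¹)) = Tl at *
  generalize τ t = T0 at *
  generalize Complex.exp (xi t μ) = A at *
  generalize Complex.exp (xi t lam) = B at *
  have hT : T = _ := eq_div_of_mul_eq ht key.symm
  rw [hT, ← neg_sub μ lam, ← neg_sub z lam]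
  field_simp
  ring
end
end

section
/- Suppose τ satisfies the Fay identity. Let t : ℕ → ℂ be finitely supported and let λ, μ, z be nonzero complex numbers with λ ≠ ±μ, λ ≠ ±z, μ ≠ ±z, and with τ(t), τ(t+2[λ⁻¹]), τ(t−2[z⁻¹]) and τ(t−2[z⁻¹]+2[λ⁻¹]) all nonzero. Then ψ(t−2[z⁻¹]+2[λ⁻¹],μ)·ψ(t−2[z⁻¹],−λ) − ψ(t+2[λ⁻¹],μ)·ψ(t,−λ) = −ψ(t,−λ)·ψ(t−2[z⁻¹],μ) + ψ(t,μ)·ψ(t−2[z⁻¹],−λ), where ψ(t,μ) = exp(ξ(t,μ))·τ(t−2[μ⁻¹])/τ(t), ψ(t,−λ) = exp(−ξ(t,λ))·τ(t+2[λ⁻¹])/τ(t), ψ(t+2[λ⁻¹],μ) = exp(ξ(t,μ))·((λ+μ)/(λ−μ))·τ(t+2[λ⁻¹]−2[μ⁻¹])/τ(t+2[λ⁻¹]), ψ(t−2[z⁻¹],μ) = exp(ξ(t,μ))·((z−μ)/(z+μ))·τ(t−2[z⁻¹]−2[μ⁻¹])/τ(t−2[z⁻¹]), ψ(t−2[z⁻¹],−λ)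 = exp(−ξ(t,λ))·((z+λ)/(z−λ))·τ(t−2[z⁻¹]+2[λ⁻¹])/τ(t−2[z⁻¹]), and ψ(t−2[z⁻¹]+2[λ⁻¹],μ) = exp(ξ(t,μ))·((z−μ)/(z+μ))·((λ+μ)/(λ−μ))·τ(t−2[z⁻¹]+2[λ⁻¹]−2[μ⁻¹])/τ(t−2[z⁻¹]+2[λ⁻¹]). (This is the tau-function form of Proposition 6.2, the Adler–Shiota–van Moerbeke formula 𝒳(λ,μ)ψ_BA(t,z) = 2Y(λ,μ)ψ_BA(t,z) for the BKP hierarchy: the left-hand side is Δ_z(𝒳(λ,μ)τ/τ)(t) with 𝒳(λ,μ)τ/τ = ψ_BA(t+2[λ⁻¹],μ)·ψ_BA(t,−λ), and the right-hand side is 2Y(λ,μ)ψ_BA(t,z) divided by ψ_BA(t,z).) -/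
open Complex

noncomputable section

/-- The Fay identity at `s₀ = 0`, in the spectral parameters `s₁ = λ⁻¹`, `s₂ = -μ⁻¹`,
`s₃ = -z⁻¹`. -/
theorem FayIdentity.bilinear {τ : (ℕ → ℂ) → ℂ} (hFay : FayIdentity τ) (t : ℕ → ℂ)
    {lam μ z : ℂ} (hlam : lam ≠ 0) (hmu : μ ≠ 0) (hz : z ≠ 0)
    (hlm : lam - μ ≠ 0) (hlm' : lam + μ ≠ 0) (hzl : z - lam ≠ 0) (hzl' : z + lam ≠ 0)
    (hzm : z - μ ≠ 0) (hzm' : z + μ ≠ 0) :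
    ((z - μ) / (z + μ)) * ((lam + μ) / (lam - μ)) * ((z + lam) / (z - lam)) *
          (τ (shift (shift (shift t (-z⁻¹)) lam⁻¹) (-μ⁻¹)) * τ t)
        - (lam + μ) / (lam - μ) *
          (τ (shift (shift t lam⁻¹) (-μ⁻¹)) * τ (shift t (-z⁻¹)))
      = -((z - μ) / (z + μ) * (τ (shift t lam⁻¹) * τ (shift (shift t (-z⁻¹)) (-μ⁻¹))))
        + (z + lam) / (z - lam) *
          (τ (shift t (-μ⁻¹)) * τ (shift (shift t (-z⁻¹)) lam⁻¹)) := by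
  have e₁₂ : lam⁻¹ - -μ⁻¹ = (lam + μ) / (lam * μ) := by field_simp; ring
  have e₁₃ : lam⁻¹ - -z⁻¹ = (z + lam) / (lam * z) := by field_simp; ring
  have e₂₃ : -μ⁻¹ - -z⁻¹ = -(z - μ) / (μ * z) := by field_simp; ring
  have f₁₂ : lam⁻¹ + -μ⁻¹ = -(lam - μ) / (lam * μ) := by field_simp; ring
  have f₁₃ : lam⁻¹ + -z⁻¹ = (z - lam) / (lam * z) := by field_simp; ring
  have f₂₃ : -μ⁻¹ + -z⁻¹ = -(z + μ) / (μ * z) := by field_simp; ring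
  have h := hFay t 0 lam⁻¹ (-μ⁻¹) (-z⁻¹) (by simpa) (by simpa) (by simpa)
    (by rw [e₁₂]; positivity) (by rw [e₁₃]; positivity)
    (by rw [e₂₃]; exact div_ne_zero (neg_ne_zero.mpr hzm) (mul_ne_zero hmu hz))
  rw [← neg_sub lam⁻¹ (-μ⁻¹), ← neg_sub lam⁻¹ (-z⁻¹), ← neg_sub (-μ⁻¹) (-z⁻¹),
    add_comm (-μ⁻¹) lam⁻¹, add_comm (-z⁻¹) lam⁻¹, add_comm (-z⁻¹) (-μ⁻¹),
    e₁₂, e₁₃, e₂₃, f₁₂, f₁₃, f₂₃] at h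
  simp only [shift_zero] at h
  rw [shift_comm t (-μ⁻¹) (-z⁻¹), shift_comm (shift t lam⁻¹) (-μ⁻¹) (-z⁻¹),
    shift_comm t lam⁻¹ (-z⁻¹)] at h
  generalize τ (shift (shift (shift t (-z⁻¹)) lam⁻¹) (-μ⁻¹)) = T₁₂₃ at h ⊢
  generalize τ (shift (shift t lam⁻¹) (-μ⁻¹)) = T₁₂ at h ⊢
  generalize τ (shift (shift t (-z⁻¹)) (-μ⁻¹)) = T₂₃ at h ⊢
  generalize τ (shift (shift t (-z⁻¹)) lam⁻¹) = T₁₃ at h ⊢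
  generalize τ (shift t lam⁻¹) = T₁ at h ⊢
  generalize τ (shift t (-μ⁻¹)) = T₂ at h ⊢
  generalize τ (shift t (-z⁻¹)) = T₃ at h ⊢
  generalize τ t = T at h ⊢
  clear e₁₂ e₁₃ e₂₃ f₁₂ f₁₃ f₂₃
  field_simp at h ⊢
  linear_combination -h

/-- The tau-function form of Proposition 6.2 (Adler–Shiota–van Moerbeke formula for BKP):
`Δ_z(𝒳(λ,μ)τ/τ)(t) = −ψ_BA(t,−λ)·ψ_BA(t−2[z⁻¹],μ) + ψ_BA(t,μ)·ψ_BA(t−2[z⁻¹],−λ)`,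
written with explicit evaluations of the Baker–Akhiezer functions. -/
theorem asvm_tau_form (τ : (ℕ → ℂ) → ℂ) (hFay : FayIdentity τ)
    (t : ℕ → ℂ) (hsupp : (Function.support t).Finite)
    (lam μ z : ℂ) (hlam : lam ≠ 0) (hmu : μ ≠ 0) (hz : z ≠ 0)
    (hlm : lam ≠ μ) (hlm' : lam ≠ -μ)
    (hlz : lam ≠ z) (hlz' : lam ≠ -z)
    (hmz : μ ≠ z) (hmz' : μ ≠ -z)
    (ht : τ t ≠ 0) (htl : τ (shift t lam⁻¹) ≠ 0)
    (htz : τ (shift t (-z⁻¹)) ≠ 0) (htzl : τ (shift (shift t (-z⁻¹)) lam⁻¹) ≠ 0) :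
    (Complex.exp (xi t μ) * ((z - μ) / (z + μ)) * ((lam + μ) / (lam - μ)) *
          τ (shift (shift (shift t (-z⁻¹)) lam⁻¹) (-μ⁻¹)) /
            τ (shift (shift t (-z⁻¹)) lam⁻¹)) *
        (Complex.exp (-xi t lam) * ((z + lam) / (z - lam)) *
          τ (shift (shift t (-z⁻¹)) lam⁻¹) / τ (shift t (-z⁻¹)))
      - (Complex.exp (xi t μ) * ((lam + μ) / (lam - μ)) *
            τ (shift (shift t lam⁻¹) (-μ⁻¹)) / τ (shift t lam⁻¹)) *
          (Complex.exp (-xi t lam) * τ (shift t lam⁻¹) / τ t)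
      = - (Complex.exp (-xi t lam) * τ (shift t lam⁻¹) / τ t) *
            (Complex.exp (xi t μ) * ((z - μ) / (z + μ)) *
              τ (shift (shift t (-z⁻¹)) (-μ⁻¹)) / τ (shift t (-z⁻¹)))
        + (Complex.exp (xi t μ) * τ (shift t (-μ⁻¹)) / τ t) *
            (Complex.exp (-xi t lam) * ((z + lam) / (z - lam)) *
              τ (shift (shift t (-z⁻¹)) lam⁻¹) / τ (shift t (-z⁻¹))) := by
  have key := hFay.bilinear t hlam hmu hz (sub_ne_zero.mpr hlm)
    (fun h => hlm' (eq_neg_of_add_eq_zero_left h)) (sub_ne_zero.mpr hlz.symm)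
    (fun h => hlz' (eq_neg_of_add_eq_zero_right h)) (sub_ne_zero.mpr hmz.symm)
    (fun h => hmz' (eq_neg_of_add_eq_zero_right h))
  generalize (z - μ) / (z + μ) = R at key ⊢
  generalize (lam + μ) / (lam - μ) = P at key ⊢
  generalize (z + lam) / (z - lam) = Q at key ⊢
  generalize τ (shift (shift (shift t (-z⁻¹)) lam⁻¹) (-μ⁻¹)) = T₁₂₃ at key ⊢
  generalize τ (shift (shift t lam⁻¹) (-μ⁻¹)) = T₁₂ at key ⊢
  generalize τ (shift (shift t (-z⁻¹)) (-μ⁻¹)) = T₂₃ at key ⊢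
  generalize τ (shift (shift t (-z⁻¹)) lam⁻¹) = T₁₃ at key htzl ⊢
  generalize τ (shift t lam⁻¹) = T₁ at key htl ⊢
  generalize τ (shift t (-μ⁻¹)) = T₂ at key ⊢
  generalize τ (shift t (-z⁻¹)) = T₃ at key htz ⊢
  generalize τ t = T at key ht ⊢
  field_simp
  linear_combination key
end
end
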